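/- For all integers 0 ≤ k < h ≤ u, if the chain Z starts at k then the overshoot at level h satisfies P(Z_{τ_h} ≥ u) ≤ (Σ_{v ≥ u} ρ(h,v)) / (Σ_{w ≥ h} ρ(h,w)). -/

import Mathlib

open MeasureTheory ProbabilityTheory
open scoped ENNReal

/-- ρ(i,j) := 2^{−i−j−1}·(i+j)!/(i!·j!). -/
noncomputable def rho (i j : ℕ) : ℝ :=
  (2 : ℝ) ^ (-(i : ℝ) - (j : ℝ) - 1) * (Nat.factorial (i + j)) /
    ((Nat.factorial i) * (Nat.factorial j))

/-- `Z` is a Markov chain with transition probabilities `trans` started at `k`: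
`P(Z_0 = k) = 1` and
`P(Z_0 = k_0, …, Z_n = k_n) = P(Z_0 = k_0) · ∏_{0 ≤ i < n} trans(k_i, k_{i+1})`. -/
def IsMarkovChainFrom {Ω : Type*} [MeasurableSpace Ω] (P : Measure Ω)
    (Z : ℕ → Ω → ℕ) (trans : ℕ → ℕ → ℝ) (k : ℕ) : Prop :=
  (∀ t, Measurable (Z t)) ∧
    ∀ (n : ℕ) (ks : ℕ → ℕ),
      P {ω | ∀ i ≤ n, Z i ω = ks i} =
        ENNReal.ofReal ((if ks 0 = k then 1 else 0) *
          ∏ i ∈ Finset.range n, trans (ks i) (ks (i + 1)))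

/-- `τ_h := inf{t ≥ 0 : Z_t ≥ h}` (with value `∞` if there is no such `t`). -/
noncomputable def tau {Ω : Type*} (Z : ℕ → Ω → ℕ) (h : ℕ) (ω : Ω) : ℕ∞ :=
  sInf ((↑) '' {t : ℕ | h ≤ Z t ω} : Set ℕ∞)

/-- The upper tail `∑_{v ≥ u} ρ(i, v)`. -/
noncomputable def rhoTail (i u : ℕ) : ℝ≥0∞ :=
  ∑' v : ℕ, ENNReal.ofReal (if u ≤ v then rho i v else 0)

/-- The event that `t` is the first time at which the process is at least `h`, and that the
process is then at least `u` (for `h ≤ u`). -/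
def firstPassage {Ω : Type*} (Z : ℕ → Ω → ℕ) (h t u : ℕ) : Set Ω :=
  {ω | (∀ s < t, Z s ω < h) ∧ u ≤ Z t ω}

theorem rho_eq (i j : ℕ) :
    rho i j = (1 / 2 : ℝ) ^ (i + j + 1) * (i + j).factorial / (i.factorial * j.factorial) := by
  have key : (2 : ℝ) ^ (-(i : ℝ) - (j : ℝ) - 1) = (1 / 2 : ℝ) ^ (i + j + 1) := by
    rw [show -(i : ℝ) - (j : ℝ) - 1 = -((i + j + 1 : ℕ) : ℝ) by push_cast; ring,
      Real.rpow_neg (by norm_num), Real.rpow_natCast, one_div, inv_pow]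
  rw [rho, key]

theorem rho_pos (i j : ℕ) : 0 < rho i j := by
  rw [rho_eq]
  positivity

theorem summable_rho (i : ℕ) : Summable (rho i) := by
  have hs := (summable_choose_mul_geometric_of_norm_lt_one (R := ℝ) i
    (r := 1 / 2) (by norm_num)).mul_left ((1 / 2 : ℝ) ^ (i + 1))
  refine hs.congr fun j => ?_
  rw [rho_eq, Nat.cast_choose ℝ (Nat.le_add_left i j), Nat.add_sub_cancel, Nat.add_comm j i]
  ring

theorem factorial_add_mul_factorial_add_le (i d : ℕ) {v w : ℕ} (hwv : w ≤ v) :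
    (i + v).factorial * (i + d + w).factorial ≤ (i + d + v).factorial * (i + w).factorial := by
  induction d with
  | zero => simp
  | succ d ih =>
    rw [show i + (d + 1) + w = (i + d + w) + 1 by ring,
      show i + (d + 1) + v = (i + d + v) + 1 by ring, Nat.factorial_succ, Nat.factorial_succ]
    calc (i + v).factorial * ((i + d + w + 1) * (i + d + w).factorial)
        = (i + d + w + 1) * ((i + v).factorial * (i + d + w).factorial) := by ring
      _ ≤ (i + d + v + 1) * ((i + d + v).factorial * (i + w).factorial) := by gcongr
      _ = _ := by ring

/-- The kernel `ρ` is totally positive of order two. -/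
theorem rho_mul_rho_le {i h v w : ℕ} (hih : i ≤ h) (hwv : w ≤ v) :
    rho i v * rho h w ≤ rho h v * rho i w := by
  obtain ⟨d, rfl⟩ := Nat.exists_eq_add_of_le hih
  have key : ((i + v).factorial : ℝ) * (i + d + w).factorial ≤
      (i + d + v).factorial * (i + w).factorial :=
    mod_cast factorial_add_mul_factorial_add_le i d hwv
  set c : ℝ := (1 / 2 : ℝ) ^ (i + v + 1 + (i + d + w + 1)) /
    (i.factorial * v.factorial * ((i + d).factorial * w.factorial)) with hc
  have hc0 : 0 ≤ c := by positivity
  calc rho i v * rho (i + d) w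
      = c * ((i + v).factorial * (i + d + w).factorial) := by
        rw [rho_eq, rho_eq, hc]
        ring
    _ ≤ c * ((i + d + v).factorial * (i + w).factorial) := by gcongr
    _ = rho (i + d) v * rho i w := by
        rw [rho_eq, rho_eq, hc]
        ring

theorem summable_ite_rho (i u : ℕ) : Summable fun v => if u ≤ v then rho i v else 0 := by
  refine (summable_rho i).of_nonneg_of_le (fun v => ?_) (fun v => ?_) <;>
    split_ifs <;> first | exact le_rfl | exact (rho_pos i v).le

theorem rhoTail_eq (i u : ℕ) :
    rhoTail i u = ENNReal.ofReal (∑' v : ℕ, if u ≤ v then rho i v else 0) := by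
  rw [ENNReal.ofReal_tsum_of_nonneg _ (summable_ite_rho i u), rhoTail]
  intro v
  split_ifs
  exacts [(rho_pos i v).le, le_rfl]

theorem tsum_ite_rho_pos (i u : ℕ) : 0 < ∑' v : ℕ, if u ≤ v then rho i v else 0 := by
  refine (summable_ite_rho i u).tsum_pos (fun v => ?_) u (by simpa using rho_pos i u)
  split_ifs
  exacts [(rho_pos i v).le, le_rfl]

theorem rhoTail_mul_rhoTail_le {i h u : ℕ} (hih : i ≤ h) (hhu : h ≤ u) :
    rhoTail i u * rhoTail h h ≤ rhoTail h u * rhoTail i h := by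
  have split (j : ℕ) : rhoTail j h =
      (∑' w : ℕ, ENNReal.ofReal (if h ≤ w ∧ w < u then rho j w else 0)) + rhoTail j u := by
    rw [rhoTail, rhoTail, ← ENNReal.tsum_add]
    refine tsum_congr fun w => ?_
    by_cases h1 : h ≤ w <;> by_cases h2 : u ≤ w
    · simp [h1, h2, not_lt.mpr h2]
    · simp [h1, h2, not_le.mp h2]
    · omega
    · simp [h1, h2]
  rw [split h, split i, mul_add, mul_add, mul_comm (rhoTail i u) (rhoTail h u)]
  gcongr ?_ + _
  simp only [rhoTail]
  rw [← ENNReal.tsum_mul_right, ← ENNReal.tsum_mul_right]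
  refine ENNReal.tsum_le_tsum fun v => ?_
  rw [← ENNReal.tsum_mul_left, ← ENNReal.tsum_mul_left]
  refine ENNReal.tsum_le_tsum fun w => ?_
  by_cases hv : u ≤ v <;> by_cases hw : h ≤ w ∧ w < u
  · rw [if_pos hv, if_pos hv, if_pos hw, if_pos hw, ← ENNReal.ofReal_mul (rho_pos _ _).le,
      ← ENNReal.ofReal_mul (rho_pos _ _).le]
    exact ENNReal.ofReal_le_ofReal (rho_mul_rho_le hih (by omega))
  all_goals simp [hv, hw]

theorem rhoTail_le {i h u : ℕ} (hih : i ≤ h) (hhu : h ≤ u) :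
    rhoTail i u ≤ ENNReal.ofReal ((∑' v : ℕ, if u ≤ v then rho h v else 0) /
      (∑' w : ℕ, if h ≤ w then rho h w else 0)) * rhoTail i h := by
  have h0 : rhoTail h h ≠ 0 := by
    rw [rhoTail_eq]
    exact (ENNReal.ofReal_pos.mpr (tsum_ite_rho_pos h h)).ne'
  have htop : rhoTail h h ≠ ∞ := by
    rw [rhoTail_eq]
    exact ENNReal.ofReal_ne_top
  rw [ENNReal.ofReal_div_of_pos (tsum_ite_rho_pos h h), ← rhoTail_eq, ← rhoTail_eq,
    ← ENNReal.mul_div_right_comm, ENNReal.le_div_iff_mul_le (.inl h0) (.inl htop)]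
  exact rhoTail_mul_rhoTail_le hih hhu

theorem measure_eq_tsum_inter_fiber {Ω β : Type*} [MeasurableSpace Ω] [Countable β]
    [MeasurableSpace β] [MeasurableSingletonClass β] (P : Measure Ω) {X : Ω → β}
    (hX : Measurable X) {A : Set Ω} (hA : MeasurableSet A) :
    P A = ∑' b, P (A ∩ {ω | X ω = b}) := by
  rw [← measure_iUnion]
  · congr 1
    ext ω
    simp
  · intro b c hbc
    refine Set.disjoint_left.mpr ?_
    rintro ω ⟨-, hb⟩ ⟨-, hc⟩
    exact hbc (hb.symm.trans hc)
  · exact fun b => hA.inter (hX (measurableSet_singleton b))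

section MarkovChain

variable {Ω : Type*} [MeasurableSpace Ω] {P : Measure Ω} {Z : ℕ → Ω → ℕ} {k : ℕ}

theorem measurableSet_cylinder (hZ : ∀ t, Measurable (Z t)) (t : ℕ) (ks : ℕ → ℕ) :
    MeasurableSet {ω | ∀ i ≤ t, Z i ω = ks i} := by
  simp only [Set.ofPred_forall]
  exact .iInter fun i => .iInter fun _ => hZ i (measurableSet_singleton _)

theorem measurableSet_firstPassage (hZ : ∀ t, Measurable (Z t)) (h t u : ℕ) :
    MeasurableSet (firstPassage Z h t u) := by
  have h1 : MeasurableSet {ω | ∀ s < t, Z s ω < h} := by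
    simp only [Set.ofPred_forall]
    exact .iInter fun s => .iInter fun _ => hZ s (measurableSet_Iio (a := h))
  exact h1.inter (hZ t (measurableSet_Ici (a := u)))

theorem IsMarkovChainFrom.measure_cylinder_inter (hM : IsMarkovChainFrom P Z rho k)
    (t u : ℕ) (ks : ℕ → ℕ) :
    P ({ω | ∀ i ≤ t, Z i ω = ks i} ∩ {ω | u ≤ Z (t + 1) ω}) =
      P {ω | ∀ i ≤ t, Z i ω = ks i} * rhoTail (ks t) u := by
  have hmeas : MeasurableSet ({ω | ∀ i ≤ t, Z i ω = ks i} ∩ {ω | u ≤ Z (t + 1) ω}) :=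
    (measurableSet_cylinder hM.1 t ks).inter (hM.1 (t + 1) (measurableSet_Ici (a := u)))
  rw [measure_eq_tsum_inter_fiber P (hM.1 (t + 1)) hmeas, rhoTail, ← ENNReal.tsum_mul_left]
  refine tsum_congr fun v => ?_
  split_ifs with huv
  · have hset : {ω | ∀ i ≤ t, Z i ω = ks i} ∩ {ω | u ≤ Z (t + 1) ω} ∩ {ω | Z (t + 1) ω = v} =
        {ω | ∀ i ≤ t + 1, Z i ω = Function.update ks (t + 1) v i} := by
      ext ω
      constructor
      · rintro ⟨⟨h1, -⟩, h3⟩ i hi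
        rcases Nat.le_succ_iff.mp hi with hi | rfl
        · rw [Function.update_of_ne (by omega)]
          exact h1 i hi
        · simpa using h3
      · intro H
        have h3 : Z (t + 1) ω = v := by simpa using H (t + 1) le_rfl
        refine ⟨⟨fun i hi => ?_, huv.trans_eq h3.symm⟩, h3⟩
        have := H i (by omega)
        rwa [Function.update_of_ne (by omega)] at this
    rw [hset, hM.2, hM.2, ← ENNReal.ofReal_mul, Finset.prod_range_succ, Function.update_self,
      Function.update_of_ne (by omega : t ≠ t + 1),
      Function.update_of_ne (by omega : 0 ≠ t + 1), mul_assoc]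
    · congr 3
      refine Finset.prod_congr rfl fun i hi => ?_
      have := Finset.mem_range.mp hi
      rw [Function.update_of_ne (by omega), Function.update_of_ne (by omega)]
    · refine mul_nonneg ?_ (Finset.prod_nonneg fun i _ => (rho_pos _ _).le)
      split_ifs <;> norm_num
  · rw [ENNReal.ofReal_zero, mul_zero]
    convert measure_empty (μ := P)
    ext ω
    simp only [Set.mem_inter_iff, Set.mem_ofPred_eq, Set.mem_empty_iff_false, iff_false]
    rintro ⟨⟨-, h2⟩, rfl⟩
    exact huv h2

theorem IsMarkovChainFrom.measure_firstPassage_zero (hM : IsMarkovChainFrom P Z rho k)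
    {h u : ℕ} (hku : k < u) : P (firstPassage Z h 0 u) = 0 := by
  rw [measure_eq_tsum_inter_fiber P (hM.1 0) (measurableSet_firstPassage hM.1 h 0 u),
    ENNReal.tsum_eq_zero]
  intro j
  by_cases hj : u ≤ j
  · have h0 := hM.2 0 fun _ => j
    simp only [Finset.range_zero, Finset.prod_empty, mul_one, if_neg (by omega : j ≠ k),
      ENNReal.ofReal_zero] at h0
    refine measure_mono_null ?_ h0
    rintro ω ⟨-, hω⟩ i hi
    obtain rfl := Nat.le_zero.mp hi
    exact hω
  · convert measure_empty (μ := P)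
    ext ω
    simp only [Set.mem_inter_iff, Set.mem_ofPred_eq, Set.mem_empty_iff_false, iff_false]
    rintro ⟨⟨-, h2⟩, rfl⟩
    exact hj h2

theorem IsMarkovChainFrom.measure_firstPassage_le (hM : IsMarkovChainFrom P Z rho k)
    {h u : ℕ} (hkh : k < h) (hhu : h ≤ u) (t : ℕ) :
    P (firstPassage Z h t u) ≤
      ENNReal.ofReal ((∑' v : ℕ, if u ≤ v then rho h v else 0) /
        (∑' w : ℕ, if h ≤ w then rho h w else 0)) * P (firstPassage Z h t h) := by
  cases t with
  | zero => simp [hM.measure_firstPassage_zero (hkh.trans_le hhu)]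
  | succ t =>
    have hX : Measurable fun ω (i : Fin (t + 1)) => Z i ω :=
      measurable_pi_lambda _ fun i => hM.1 i
    rw [measure_eq_tsum_inter_fiber P hX (measurableSet_firstPassage hM.1 h (t + 1) u),
      measure_eq_tsum_inter_fiber P hX (measurableSet_firstPassage hM.1 h (t + 1) h),
      ← ENNReal.tsum_mul_left]
    refine ENNReal.tsum_le_tsum fun p => ?_
    set ks : ℕ → ℕ := fun i => if hi : i < t + 1 then p ⟨i, hi⟩ else 0 with hks
    have hfib (ω : Ω) : (fun i : Fin (t + 1) => Z i ω) = p ↔ ∀ i ≤ t, Z i ω = ks i := by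
      rw [funext_iff, Fin.forall_iff]
      refine forall_congr' fun i => ?_
      rw [← Nat.lt_succ_iff]
      refine forall_congr' fun hi => ?_
      simp only [hks, dif_pos hi]
    by_cases hp : ∀ s ≤ t, ks s < h
    · have hset (x : ℕ) : firstPassage Z h (t + 1) x ∩ {ω | (fun i : Fin (t + 1) => Z i ω) = p} =
          {ω | ∀ i ≤ t, Z i ω = ks i} ∩ {ω | x ≤ Z (t + 1) ω} := by
        ext ω
        simp only [firstPassage, Set.mem_inter_iff, Set.mem_ofPred_eq, hfib]
        constructor
        · rintro ⟨⟨-, h2⟩, h3⟩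
          exact ⟨h3, h2⟩
        · rintro ⟨h3, h2⟩
          refine ⟨⟨fun s hs => ?_, h2⟩, h3⟩
          rw [h3 s (by omega)]
          exact hp s (by omega)
      rw [hset, hset, hM.measure_cylinder_inter, hM.measure_cylinder_inter, mul_left_comm]
      gcongr
      exact rhoTail_le (hp t le_rfl).le hhu
    · refine Eq.trans_le (b := 0) ?_ (by simp)
      convert measure_empty (μ := P)
      ext ω
      simp only [firstPassage, Set.mem_inter_iff, Set.mem_ofPred_eq, hfib,
        Set.mem_empty_iff_false, iff_false]
      rintro ⟨⟨h1, -⟩, h3⟩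
      refine hp fun s hs => ?_
      rw [← h3 s hs]
      exact h1 s (by omega)

theorem tsum_measure_firstPassage_le_one [IsProbabilityMeasure P]
    (hZ : ∀ t, Measurable (Z t)) (h : ℕ) : ∑' t, P (firstPassage Z h t h) ≤ 1 := by
  rw [← measure_iUnion]
  · exact prob_le_one
  · intro s t hst
    refine Set.disjoint_left.mpr ?_
    rintro ω ⟨h1, h2⟩ ⟨h3, h4⟩
    rcases lt_or_gt_of_ne hst with hlt | hlt
    · exact (h3 s hlt).not_ge h2
    · exact (h1 t hlt).not_ge h4
  · exact fun t => measurableSet_firstPassage hZ h t h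

end MarkovChain

theorem setOf_tau_subset {Ω : Type*} (Z : ℕ → Ω → ℕ) (h u : ℕ) :
    {ω | ∃ t : ℕ, tau Z h ω = (t : ℕ∞) ∧ u ≤ Z t ω} ⊆ ⋃ t, firstPassage Z h t u := by
  rintro ω ⟨t, ht, hu⟩
  refine Set.mem_iUnion.mpr ⟨t, fun s hs => ?_, hu⟩
  by_contra! hle
  have : tau Z h ω ≤ (s : ℕ∞) := sInf_le ⟨s, hle, rfl⟩
  rw [ht] at this
  exact hs.not_ge (by exact_mod_cast this)

/-- For all integers 0 ≤ k < h ≤ u, if the chain Z starts at k then the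
overshoot at level h satisfies
P(Z_{τ_h} ≥ u) ≤ (Σ_{v ≥ u} ρ(h,v)) / (Σ_{w ≥ h} ρ(h,w)). -/
theorem stmt_19 :
    ∀ (h k u : ℕ), k < h → h ≤ u →
      ∀ (Ω : Type) (_ : MeasurableSpace Ω) (P : Measure Ω) (Z : ℕ → Ω → ℕ),
        IsProbabilityMeasure P → IsMarkovChainFrom P Z rho k →
        P {ω | ∃ t : ℕ, tau Z h ω = (t : ℕ∞) ∧ u ≤ Z t ω} ≤
          ENNReal.ofReal ((∑' v : ℕ, if u ≤ v then rho h v else 0) /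
            (∑' w : ℕ, if h ≤ w then rho h w else 0)) := by
  intro h k u hkh hhu Ω _ P Z _ hM
  calc P {ω | ∃ t : ℕ, tau Z h ω = (t : ℕ∞) ∧ u ≤ Z t ω}
      ≤ ∑' t, P (firstPassage Z h t u) :=
        (measure_mono (setOf_tau_subset Z h u)).trans (measure_iUnion_le _)
    _ ≤ ∑' t, _ * P (firstPassage Z h t h) :=
        ENNReal.tsum_le_tsum (hM.measure_firstPassage_le hkh hhu)
    _ = _ * ∑' t, P (firstPassage Z h t h) := ENNReal.tsum_mul_left
    _ ≤ _ := mul_le_of_le_one_right' (tsum_measure_firstPassage_le_one hM.1 h)
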